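/- arXiv:1307.2458 — 2 statements merged into one kernel-verified Lean document; each statement's English description precedes it below -/
import Mathlib

section
/- Let α ∈ ℝ⁶ satisfy α₁ ≥ α₂ ≥ α₃ ≥ α₄ ≥ α₅ ≥ α₆ ≥ α₁ − 1 and α₁ + ⋯ + α₆ = 1. If α₁ + α₂ ≤ 1 and α₄ + α₅ ≥ 0, then for every ζ ∈ [0, 1/2] one has fob(α, 0) ≤ fob(α, ζ) ≤ fob(α, 1/2); that is, on [0, 1/2] the function fob(α, ·) attains its minimum at ζ = 0 and its maximum at ζ = 1/2. -/
/-- `g(x) = x(x-1)(2x-1)/6`. -/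
noncomputable def g (x : ℝ) : ℝ := x * (x - 1) * (2 * x - 1) / 6

/-- The first order behavior
`fob(α, ζ) = Σ_{1≤r<s≤6} g({α_r + α_s}) − Σ_{r=1}^{6} ( g({α_r − ζ}) + g({α_r + ζ}) )`. -/
noncomputable def fob (α : Fin 6 → ℝ) (ζ : ℝ) : ℝ :=
  (∑ r : Fin 6, ∑ s : Fin 6, if r < s then g (Int.fract (α r + α s)) else 0)
  - ∑ r : Fin 6, (g (Int.fract (α r - ζ)) + g (Int.fract (α r + ζ)))

open Set

section Concave

variable {f : ℝ → ℝ} {s : Set ℝ}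

/-- Two points with the same sum as the endpoints of an interval containing them. -/
lemma ConcaveOn.add_le_add_of_add_eq (hf : ConcaveOn ℝ s f) {p q x y : ℝ}
    (hp : p ∈ s) (hq : q ∈ s) (hpx : p ≤ x) (hpy : p ≤ y) (hsum : x + y = p + q) :
    f p + f q ≤ f x + f y := by
  rcases eq_or_lt_of_le (show p ≤ q by linarith) with h | h
  · obtain rfl : x = p := by linarith
    obtain rfl : y = q := by linarith
    rfl
  · have hd : 0 < q - p := by linarith
    have hx := hf.2 hp hq
      (div_nonneg (by linarith) hd.le : 0 ≤ (q - x) / (q - p))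
      (div_nonneg (by linarith) hd.le : 0 ≤ (x - p) / (q - p)) (by field_simp; ring)
    have hy := hf.2 hp hq
      (div_nonneg (by linarith) hd.le : 0 ≤ (x - p) / (q - p))
      (div_nonneg (by linarith) hd.le : 0 ≤ (q - x) / (q - p)) (by field_simp; ring)
    have ex : (q - x) / (q - p) * p + (x - p) / (q - p) * q = x := by field_simp; ring
    have ey : (x - p) / (q - p) * p + (q - x) / (q - p) * q = y := by
      obtain rfl : y = p + q - x := by linarith
      field_simp; ring
    have e : (q - x) / (q - p) + (x - p) / (q - p) = 1 := by field_simp; ring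
    simp only [smul_eq_mul] at hx hy
    rw [ex] at hx
    rw [ey] at hy
    linear_combination hx + hy - (f p + f q) * e

/-- Karamata's inequality for three points of an interval. -/
lemma ConcaveOn.add_add_le_add_add_of_mem_Icc (hf : ConcaveOn ℝ s f) {p q r x y z : ℝ}
    (hs : Icc p r ⊆ s) (hq : q ∈ Icc p r) (hx : x ∈ Icc p r) (hy : y ∈ Icc p r)
    (hz : z ∈ Icc p r) (hsum : x + y + z = p + q + r) :
    f p + f q + f r ≤ f x + f y + f z := by
  obtain ⟨hq₁, hq₂⟩ := hq
  obtain ⟨hx₁, hx₂⟩ := hx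
  obtain ⟨hy₁, hy₂⟩ := hy
  obtain ⟨hz₁, hz₂⟩ := hz
  rcases le_total (x + z - p) r with h | h
  · have h₁ := hf.add_le_add_of_add_eq (p := p) (q := x + z - p) (x := x) (y := z)
      (hs ⟨by linarith, by linarith⟩) (hs ⟨by linarith, h⟩) hx₁ hz₁ (by ring)
    have h₂ := hf.add_le_add_of_add_eq (p := q) (q := r) (x := y) (y := x + z - p)
      (hs ⟨hq₁, hq₂⟩) (hs ⟨by linarith, le_rfl⟩) (by linarith) (by linarith) (by linarith)
    linarith
  · have h₁ := hf.add_le_add_of_add_eq (p := x + z - r) (q := r) (x := x) (y := z)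
      (hs ⟨by linarith, by linarith⟩) (hs ⟨by linarith, le_rfl⟩) (by linarith) (by linarith)
      (by ring)
    have h₂ := hf.add_le_add_of_add_eq (p := p) (q := q) (x := y) (y := x + z - r)
      (hs ⟨le_rfl, by linarith⟩) (hs ⟨hq₁, hq₂⟩) (by linarith) (by linarith) (by linarith)
    linarith

end Concave

section HalfInterval

variable {f : ℝ → ℝ}

lemma ConcaveOn.nonneg_of_endpoints_eq_zero (hf : ConcaveOn ℝ (Icc 0 (1 / 2)) f) (h₀ : f 0 = 0)
    (h₁ : f (1 / 2) = 0) {x : ℝ} (hx : x ∈ Icc (0 : ℝ) (1 / 2)) : 0 ≤ f x := by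
  have h := hf.2 (show (0 : ℝ) ∈ Icc 0 (1 / 2) by norm_num)
    (show (1 / 2 : ℝ) ∈ Icc 0 (1 / 2) by norm_num) (show 0 ≤ 1 - 2 * x by linarith [hx.2])
    (show 0 ≤ 2 * x by linarith [hx.1]) (by ring)
  simp only [h₀, h₁, smul_eq_mul, mul_zero, zero_add] at h
  rwa [show 2 * x * (1 / 2) = x by ring] at h

lemma ConcaveOn.map_add_le_of_map_zero (hf : ConcaveOn ℝ (Icc 0 (1 / 2)) f) (h₀ : f 0 = 0)
    {x y : ℝ} (hx : 0 ≤ x) (hy : 0 ≤ y) (hxy : x + y ≤ 1 / 2) : f (x + y) ≤ f x + f y := by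
  have := hf.add_le_add_of_add_eq (p := 0) (q := x + y) (x := x) (y := y)
    ⟨le_rfl, by norm_num⟩ ⟨by linarith, hxy⟩ hx hy (by ring)
  linarith

lemma ConcaveOn.map_add_sub_half_le (hf : ConcaveOn ℝ (Icc 0 (1 / 2)) f) (h₁ : f (1 / 2) = 0)
    {x y : ℝ} (hx : x ≤ 1 / 2) (hy : y ≤ 1 / 2) (hxy : 1 / 2 ≤ x + y) :
    f (x + y - 1 / 2) ≤ f x + f y := by
  have := hf.add_le_add_of_add_eq (p := x + y - 1 / 2) (q := 1 / 2) (x := x) (y := y)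
    ⟨by linarith, by linarith⟩ ⟨by norm_num, le_rfl⟩ (by linarith) (by linarith) (by ring)
  linarith

lemma ConcaveOn.add_le_sum_four (hf : ConcaveOn ℝ (Icc 0 (1 / 2)) f) (h₁ : f (1 / 2) = 0)
    {a b w x y z : ℝ} (ha : 0 ≤ a) (hab : a ≤ b) (hb : b ≤ 1 / 2) (hw : w ≤ 1 / 2)
    (hx : x ≤ 1 / 2) (hy : y ∈ Icc a (1 / 2)) (hz : z ∈ Icc a (1 / 2))
    (hwx : 1 / 2 + a ≤ w + x) (hsum : w + x + y + z = 1 + a + b) :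
    f a + f b ≤ f w + f x + f y + f z := by
  have hm := hf.map_add_sub_half_le h₁ hw hx (by linarith)
  have := hf.add_add_le_add_add_of_mem_Icc (p := a) (q := b) (r := 1 / 2)
    (Icc_subset_Icc_left ha) ⟨hab, hb⟩ (x := w + x - 1 / 2) ⟨by linarith, by linarith⟩ hy hz
    (by linarith)
  linarith

/-- The key inequality: it only uses that `f` is odd, `1`-periodic and concave on `[0, 1/2]`. -/
lemma sum_nonneg_of_odd_of_periodic_of_concaveOn (hodd : f.Odd) (hper : f.Periodic 1)
    (hf : ConcaveOn ℝ (Icc 0 (1 / 2)) f) {α : Fin 6 → ℝ}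
    (h01 : α 1 ≤ α 0) (h12 : α 2 ≤ α 1) (h23 : α 3 ≤ α 2)
    (h34 : α 4 ≤ α 3) (h45 : α 5 ≤ α 4) (h50 : α 0 - 1 ≤ α 5)
    (hsum : ∑ r, α r = 1) (hA : α 0 + α 1 ≤ 1) (hB : 0 ≤ α 3 + α 4) :
    0 ≤ ∑ r, f (α r) := by
  have h₀ : f 0 = 0 := by have := hodd 0; simp at this; linarith
  have hrefl (x : ℝ) : f (1 - x) = -f x := by rw [← hodd x, ← hper (-x)]; ring_nf
  have h₁ : f (1 / 2) = 0 := by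
    have := hrefl (1 / 2)
    rw [show (1 : ℝ) - 1 / 2 = 1 / 2 by norm_num] at this
    linarith
  have hnn {x : ℝ} (hx : 0 ≤ x) (hx' : x ≤ 1 / 2) : 0 ≤ f x :=
    hf.nonneg_of_endpoints_eq_zero h₀ h₁ ⟨hx, hx'⟩
  simp only [Fin.sum_univ_six] at hsum ⊢
  rcases le_or_gt (α 0) (1 / 2) with h0 | h0
  · have f0 := hnn (x := α 0) (by linarith) (by linarith)
    have f1 := hnn (x := α 1) (by linarith) (by linarith)
    have f2 := hnn (x := α 2) (by linarith) (by linarith)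
    have f3 := hnn (x := α 3) (by linarith) (by linarith)
    rcases le_or_gt 0 (α 5) with h5 | h5
    · have f4 := hnn (x := α 4) (by linarith) (by linarith)
      have f5 := hnn h5 (by linarith)
      linarith
    have e5 := hodd (α 5)
    rcases le_or_gt 0 (α 4) with h4 | h4
    · have f4 := hnn h4 (by linarith)
      rcases le_or_gt (α 5) (-1 / 2) with h5' | h5'
      · have := hnn (x := α 5 + 1) (by linarith) (by linarith)
        rw [hper] at this
        linarith
      rcases le_or_gt (α 3 + α 4) (1 / 2) with h | h
      · have hm := hf.map_add_le_of_map_zero h₀ (by linarith) h4 h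
        rcases le_or_gt (1 / 2) (α 0 + α 1) with h' | h'
        · have := hf.add_le_sum_four h₁ (a := 0) (b := -α 5) (w := α 0) (x := α 1) (y := α 2)
            (z := α 3 + α 4) le_rfl (by linarith) (by linarith) h0 (by linarith)
            ⟨by linarith, by linarith⟩ ⟨by linarith, h⟩ (by linarith) (by linarith)
          linarith
        · have := hf.add_le_sum_four h₁ (a := 0) (b := -α 5) (w := α 0) (x := α 3 + α 4)
            (y := α 1) (z := α 2) le_rfl (by linarith) (by linarith) h0 h
            ⟨by linarith, by linarith⟩ ⟨by linarith, by linarith⟩ (by linarith) (by linarith)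
          linarith
      · have m₁ := hf.map_add_sub_half_le h₁ (x := α 3) (y := α 4) (by linarith) (by linarith) h.le
        have m₂ := hf.map_add_sub_half_le h₁ (x := α 0) (y := α 1) h0 (by linarith) (by linarith)
        have m₃ := hf.map_add_le_of_map_zero h₀ (x := α 0 + α 1 - 1 / 2) (y := α 2)
          (by linarith) (by linarith) (by linarith)
        have m₄ := hf.map_add_le_of_map_zero h₀ (x := α 0 + α 1 - 1 / 2 + α 2)
          (y := α 3 + α 4 - 1 / 2) (by linarith) (by linarith) (by linarith)
        rw [show α 0 + α 1 - 1 / 2 + α 2 + (α 3 + α 4 - 1 / 2) = -α 5 by linarith] at m₄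
        linarith
    · have e4 := hodd (α 4)
      rcases le_or_gt (-1 / 2) (α 5) with h5' | h5'
      · have := hf.add_le_sum_four h₁ (a := -α 4) (b := -α 5) (w := α 0) (x := α 1) (y := α 2)
          (z := α 3) (by linarith) (by linarith) (by linarith) h0 (by linarith)
          ⟨by linarith, by linarith⟩ ⟨by linarith, by linarith⟩ (by linarith) (by linarith)
        linarith
      · have m₁ := hf.map_add_sub_half_le h₁ (x := α 0) (y := α 1) h0 (by linarith) (by linarith)
        have m₂ := hf.map_add_sub_half_le h₁ (x := α 2) (y := α 3) (by linarith) (by linarith)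
          (by linarith)
        have m₃ := hf.map_add_sub_half_le h₁ (x := α 0 + α 1 - 1 / 2) (y := α 2 + α 3 - 1 / 2)
          (by linarith) (by linarith) (by linarith)
        have m₄ := hf.map_add_sub_half_le h₁
          (x := α 0 + α 1 - 1 / 2 + (α 2 + α 3 - 1 / 2) - 1 / 2) (y := α 5 + 1)
          (by linarith) (by linarith) (by linarith)
        rw [hper, show α 0 + α 1 - 1 / 2 + (α 2 + α 3 - 1 / 2) - 1 / 2 + (α 5 + 1) - 1 / 2
          = -α 4 by linarith] at m₄
        linarith
  · have e0 := hrefl (α 0)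
    rcases le_or_gt 0 (α 5) with h5 | h5
    · have m₁ := hf.map_add_le_of_map_zero h₀ (x := α 4) (y := α 5)
        (by linarith) h5 (by linarith)
      have m₂ := hf.map_add_le_of_map_zero h₀ (x := α 3) (y := α 4 + α 5)
        (by linarith) (by linarith) (by linarith)
      have m₃ := hf.map_add_le_of_map_zero h₀ (x := α 2) (y := α 3 + (α 4 + α 5))
        (by linarith) (by linarith) (by linarith)
      have m₄ := hf.map_add_le_of_map_zero h₀ (x := α 1) (y := α 2 + (α 3 + (α 4 + α 5)))
        (by linarith) (by linarith) (by linarith)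
      rw [show α 1 + (α 2 + (α 3 + (α 4 + α 5))) = 1 - α 0 by linarith] at m₄
      linarith
    have e5 := hodd (α 5)
    rcases le_or_gt 0 (α 4) with h4 | h4
    · have hm := hf.map_add_le_of_map_zero h₀ (x := α 3) (y := α 4) (by linarith) h4 (by linarith)
      have := hf.add_add_le_add_add_of_mem_Icc (p := 0) (q := -α 5) (r := 1 - α 0)
        (x := α 1) (y := α 2) (z := α 3 + α 4) (Icc_subset_Icc_right (by linarith))
        ⟨by linarith, by linarith⟩ ⟨by linarith, by linarith⟩ ⟨by linarith, by linarith⟩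
        ⟨by linarith, by linarith⟩ (by linarith)
      linarith
    · have e4 := hodd (α 4)
      have := hf.add_add_le_add_add_of_mem_Icc (p := -α 4) (q := -α 5) (r := 1 - α 0)
        (x := α 1) (y := α 2) (z := α 3) (Icc_subset_Icc (by linarith) (by linarith))
        ⟨by linarith, by linarith⟩ ⟨by linarith, by linarith⟩ ⟨by linarith, by linarith⟩
        ⟨by linarith, by linarith⟩ (by linarith)
      linarith

end HalfInterval

lemma g_fract_neg (x : ℝ) : g (Int.fract (-x)) = -g (Int.fract x) := by
  by_cases h : Int.fract x = 0
  · simp [h, Int.fract_neg_eq_zero.2 h, g]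
  · rw [Int.fract_neg h]
    unfold g
    ring

lemma g_fract_eq {x : ℝ} (h₀ : -1 ≤ x) (h₁ : x ≤ 1) :
    g (Int.fract x) = g x + max (-x) 0 ^ 2 := by
  rcases lt_or_ge x 0 with h | h
  · have hx : Int.fract x = x + 1 := by
      rw [← Int.fract_add_one, Int.fract_eq_self.2 ⟨by linarith, by linarith⟩]
    rw [hx, max_eq_left (by linarith)]
    unfold g
    ring
  · rw [max_eq_right (by linarith)]
    rcases h₁.eq_or_lt with rfl | h'
    · simp [g]
    · simp [Int.fract_eq_self.2 ⟨h, h'⟩]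

/-- A difference of shifted squared positive parts is a supremum of affine functions. -/
lemma convexOn_sq_max_sub_sq_max {s t : ℝ} (hst : s ≤ t) :
    ConvexOn ℝ univ fun x : ℝ ↦ max (t - x) 0 ^ 2 - max (s - x) 0 ^ 2 := by
  have lower {w : ℝ} (hw₀ : 0 ≤ w) (hw₁ : w ≤ t - s) (y : ℝ) :
      2 * w * (t - y) - w ^ 2 ≤ max (t - y) 0 ^ 2 - max (s - y) 0 ^ 2 := by
    rcases le_total (s - y) 0 with h | h
    · rw [max_eq_right h]
      rcases le_total (t - y) 0 with h' | h'
      · rw [max_eq_right h']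
        nlinarith
      · rw [max_eq_left h']
        nlinarith [sq_nonneg (t - y - w)]
    · rw [max_eq_left h, max_eq_left (by linarith)]
      nlinarith [mul_nonneg h (sub_nonneg.2 hw₁), sq_nonneg (t - s - w)]
  have attained (y : ℝ) : ∃ w, 0 ≤ w ∧ w ≤ t - s ∧
      max (t - y) 0 ^ 2 - max (s - y) 0 ^ 2 = 2 * w * (t - y) - w ^ 2 := by
    rcases le_total (s - y) 0 with h | h
    · rcases le_total (t - y) 0 with h' | h'
      · exact ⟨0, le_rfl, by linarith, by simp [h, h']⟩
      · exact ⟨t - y, h', by linarith, by rw [max_eq_right h, max_eq_left h']; ring⟩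
    · exact ⟨t - s, by linarith, le_rfl, by
        rw [max_eq_left h, max_eq_left (by linarith)]; ring⟩
  refine ⟨convex_univ, fun x _ y _ a b ha hb hab ↦ ?_⟩
  obtain ⟨w, hw₀, hw₁, hw⟩ := attained (a • x + b • y)
  simp only [smul_eq_mul] at hw ⊢
  rw [hw]
  have hx := mul_le_mul_of_nonneg_left (lower hw₀ hw₁ x) ha
  have hy := mul_le_mul_of_nonneg_left (lower hw₀ hw₁ y) hb
  obtain rfl : b = 1 - a := by linarith
  linarith

/-- The contribution of a single `α r = x` to `fob α t - fob α s`. -/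
noncomputable def fobIncrement (s t x : ℝ) : ℝ :=
  g (Int.fract (x - s)) + g (Int.fract (x + s)) - (g (Int.fract (x - t)) + g (Int.fract (x + t)))

lemma fobIncrement_odd (s t : ℝ) : (fobIncrement s t).Odd := by
  intro x
  have h (u : ℝ) : g (Int.fract (-x - u)) = -g (Int.fract (x + u)) := by
    rw [← g_fract_neg]; ring_nf
  have h' (u : ℝ) : g (Int.fract (-x + u)) = -g (Int.fract (x - u)) := by
    rw [← g_fract_neg]; ring_nf
  simp only [fobIncrement, h, h']
  ring

lemma fobIncrement_periodic (s t : ℝ) : (fobIncrement s t).Periodic 1 := by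
  intro x
  simp only [fobIncrement, add_sub_right_comm, add_right_comm x 1, Int.fract_add_one]

lemma fobIncrement_eq {s t x : ℝ} (hs : 0 ≤ s) (hst : s ≤ t) (ht : t ≤ 1 / 2)
    (hx : x ∈ Icc (0 : ℝ) (1 / 2)) :
    fobIncrement s t x =
      (1 - 2 * x) * (t ^ 2 - s ^ 2) - (max (t - x) 0 ^ 2 - max (s - x) 0 ^ 2) := by
  obtain ⟨hx₀, hx₁⟩ := hx
  have h {u : ℝ} (hu₀ : 0 ≤ u) (hu₁ : u ≤ 1 / 2) :
      g (Int.fract (x - u)) + g (Int.fract (x + u))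
        = 2 * g x + (2 * x - 1) * u ^ 2 + max (u - x) 0 ^ 2 := by
    rw [g_fract_eq (by linarith) (by linarith), g_fract_eq (by linarith) (by linarith),
      max_eq_right (show -(x + u) ≤ 0 by linarith), neg_sub]
    unfold g
    ring
  rw [fobIncrement, h hs (hst.trans ht), h (hs.trans hst) ht]
  ring

lemma concaveOn_fobIncrement {s t : ℝ} (hs : 0 ≤ s) (hst : s ≤ t) (ht : t ≤ 1 / 2) :
    ConcaveOn ℝ (Icc 0 (1 / 2)) (fobIncrement s t) := by
  refine ⟨convex_Icc _ _, fun x hx y hy a b ha hb hab ↦ ?_⟩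
  have hc := (convexOn_sq_max_sub_sq_max hst).2 (mem_univ x) (mem_univ y) ha hb hab
  rw [fobIncrement_eq hs hst ht hx, fobIncrement_eq hs hst ht hy,
    fobIncrement_eq hs hst ht (convex_Icc _ _ hx hy ha hb hab)]
  simp only [smul_eq_mul] at hc ⊢
  linear_combination hc + (t ^ 2 - s ^ 2) * hab

lemma fob_sub_fob (α : Fin 6 → ℝ) (s t : ℝ) :
    fob α t - fob α s = ∑ r, fobIncrement s t (α r) := by
  simp only [fob, fobIncrement, Finset.sum_sub_distrib]
  ring

/-- In this case `fob α` is monotone on `[0, 1/2]`. -/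
lemma monotoneOn_fob {α : Fin 6 → ℝ}
    (h01 : α 1 ≤ α 0) (h12 : α 2 ≤ α 1) (h23 : α 3 ≤ α 2)
    (h34 : α 4 ≤ α 3) (h45 : α 5 ≤ α 4) (h50 : α 0 - 1 ≤ α 5)
    (hsum : ∑ r, α r = 1) (hA : α 0 + α 1 ≤ 1) (hB : 0 ≤ α 3 + α 4) :
    MonotoneOn (fob α) (Icc 0 (1 / 2)) := by
  intro s hs t ht hst
  rw [← sub_nonneg, fob_sub_fob]
  exact sum_nonneg_of_odd_of_periodic_of_concaveOn (fobIncrement_odd s t)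
    (fobIncrement_periodic s t) (concaveOn_fobIncrement hs.1 hst ht.2) h01 h12 h23 h34 h45 h50
    hsum hA hB

/-- Case `α₁+α₂ ≤ 1`, `α₄+α₅ ≥ 0`: on `[0, 1/2]` the function `fob(α, ·)` is
minimized at `ζ = 0` and maximized at `ζ = 1/2`. -/
theorem fob_min_at_zero_max_at_half
    (α : Fin 6 → ℝ)
    (h01 : α 1 ≤ α 0) (h12 : α 2 ≤ α 1) (h23 : α 3 ≤ α 2)
    (h34 : α 4 ≤ α 3) (h45 : α 5 ≤ α 4) (h50 : α 0 - 1 ≤ α 5)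
    (hsum : ∑ r, α r = 1)
    (hA : α 0 + α 1 ≤ 1) (hB : 0 ≤ α 3 + α 4) :
    ∀ ζ ∈ Set.Icc (0 : ℝ) (1 / 2),
      fob α 0 ≤ fob α ζ ∧ fob α ζ ≤ fob α (1 / 2) := by
  intro ζ hζ
  have hmono := monotoneOn_fob h01 h12 h23 h34 h45 h50 hsum hA hB
  exact ⟨hmono ⟨le_rfl, by norm_num⟩ hζ hζ.1, hmono hζ ⟨by norm_num, le_rfl⟩ hζ.2⟩
end

section
/- Let α ∈ ℝ⁶ and ζ ∈ ℝ satisfy α₁ ≥ α₂ ≥ α₃ ≥ α₄ ≥ α₅ ≥ α₆ ≥ −ζ, 0 ≤ ζ ≤ α₄ + α₅ + α₆, and α₁ + ⋯ + α₆ = 1. Then fob(α, ζ) = 0 if and only if ζ = 0 or α₆ + ζ = 0. -/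
theorem g_fract_of_nonneg {x : ℝ} (h0 : 0 ≤ x) (h1 : x ≤ 1) : g (Int.fract x) = g x := by
  rcases h1.lt_or_eq with h | rfl
  · rw [Int.fract_eq_self.2 ⟨h0, h⟩]
  · simp [g]

/-- Uses `g (x + 1) = g x + x ^ 2`. -/
theorem g_fract_eq_add_min_sq {x : ℝ} (h0 : -1 ≤ x) (h1 : x ≤ 1) :
    g (Int.fract x) = g x + min x 0 ^ 2 := by
  rcases le_total 0 x with h | h
  · simp [g_fract_of_nonneg h h1, min_eq_right h]
  · rw [← Int.fract_add_one x, g_fract_of_nonneg (by linarith) (by linarith), min_eq_left h]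
    unfold g
    ring

/-- On the fundamental domain the only arguments that leave `[0, 1]` are `α₅ + α₆` and the
`α_r - ζ`, and the polynomial parts of `fob` add up to `4ζ²`. -/
theorem fob_eq_on_fundamental_domain
    (α : Fin 6 → ℝ) (ζ : ℝ)
    (h01 : α 1 ≤ α 0) (h12 : α 2 ≤ α 1) (h23 : α 3 ≤ α 2)
    (h34 : α 4 ≤ α 3) (h45 : α 5 ≤ α 4) (h5ζ : -ζ ≤ α 5)
    (hζ1 : ζ ≤ α 3 + α 4 + α 5)
    (hsum : ∑ r, α r = 1) :
    fob α ζ = 4 * ζ ^ 2 + min (α 4 + α 5) 0 ^ 2 - ∑ r, min (α r - ζ) 0 ^ 2 := by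
  simp only [Fin.sum_univ_six] at hsum
  have h35 : 0 ≤ α 3 + α 5 := by
    by_contra!
    linarith
  have hpair : ∀ r s : Fin 6, 0 ≤ α r + α s → α r + α s ≤ 1 →
      g (Int.fract (α r + α s)) = g (α r + α s) := fun r s => g_fract_of_nonneg
  have hbounds : ∀ r, α 5 ≤ α r ∧ α r ≤ α 0 := by
    intro r
    fin_cases r <;> constructor <;> dsimp <;> linarith
  have hsub : ∀ r, g (Int.fract (α r - ζ)) = g (α r - ζ) + min (α r - ζ) 0 ^ 2 := fun r =>
    g_fract_eq_add_min_sq (by linarith [hbounds r]) (by linarith [hbounds r])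
  have hadd : ∀ r, g (Int.fract (α r + ζ)) = g (α r + ζ) := fun r =>
    g_fract_of_nonneg (by linarith [hbounds r]) (by linarith [hbounds r])
  have h45' := g_fract_eq_add_min_sq (x := α 4 + α 5) (by linarith) (by linarith)
  unfold fob
  simp only [hsub, hadd]
  simp only [Fin.sum_univ_six, Fin.reduceLT, if_true, if_false, lt_self_iff_false]
  rw [hpair 0 1, hpair 0 2, hpair 0 3, hpair 0 4, hpair 0 5, hpair 1 2, hpair 1 3, hpair 1 4,
    hpair 1 5, hpair 2 3, hpair 2 4, hpair 2 5, hpair 3 4, hpair 3 5, h45']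
  · rw [show α 0 = 1 - α 1 - α 2 - α 3 - α 4 - α 5 by linarith]
    unfold g
    ring
  all_goals linarith

/-- On the fundamental domain, `fob(α, ζ) = 0` iff `ζ = 0` or `α₆ + ζ = 0`. -/
theorem fob_vanishes_iff_on_fundamental_domain
    (α : Fin 6 → ℝ) (ζ : ℝ)
    (h01 : α 1 ≤ α 0) (h12 : α 2 ≤ α 1) (h23 : α 3 ≤ α 2)
    (h34 : α 4 ≤ α 3) (h45 : α 5 ≤ α 4) (h5ζ : -ζ ≤ α 5)
    (hζ0 : 0 ≤ ζ) (hζ1 : ζ ≤ α 3 + α 4 + α 5)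
    (hsum : ∑ r, α r = 1) :
    fob α ζ = 0 ↔ ζ = 0 ∨ α 5 + ζ = 0 := by
  rw [fob_eq_on_fundamental_domain α ζ h01 h12 h23 h34 h45 h5ζ hζ1 hsum, Fin.sum_univ_six]
  constructor
  · intro h
    by_contra! hne
    have hζ : 0 < ζ := lt_of_le_of_ne hζ0 (Ne.symm hne.1)
    have hf : 0 < α 5 + ζ := lt_of_le_of_ne (by linarith) (Ne.symm hne.2)
    rcases le_total ζ (α 3) with h3 | h3
    · rw [min_eq_right (a := α 0 - ζ) (by linarith), min_eq_right (a := α 1 - ζ) (by linarith),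
        min_eq_right (a := α 2 - ζ) (by linarith), min_eq_right (a := α 3 - ζ) (by linarith)] at h
      rcases le_total ζ (α 4) with h4 | h4
      · rw [min_eq_right (a := α 4 - ζ) (by linarith),
          min_eq_right (a := α 4 + α 5) (by linarith)] at h
        rcases le_total ζ (α 5) with h5 | h5
        · rw [min_eq_right (by linarith)] at h
          nlinarith
        · rw [min_eq_left (by linarith)] at h
          nlinarith
      · rw [min_eq_left (a := α 4 - ζ) (by linarith), min_eq_left (a := α 5 - ζ) (by linarith)] at h
        rcases le_total 0 (α 4 + α 5) with hs | hs
        · rw [min_eq_right hs] at h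
          nlinarith
        · rw [min_eq_left hs] at h
          have : 0 < (α 4 + ζ) * (α 5 + ζ) := mul_pos (by linarith) hf
          nlinarith
    · have hx : 0 ≤ ζ - α 3 := by linarith
      have hmin : ∀ t, α 3 ≤ t → min (t - ζ) 0 ^ 2 ≤ (ζ - α 3) ^ 2 := by
        intro t ht
        rcases le_total t ζ with h' | h'
        · rw [min_eq_left (by linarith)]
          nlinarith
        · rw [min_eq_right (by linarith)]
          nlinarith
      have h0 := hmin (α 0) (by linarith)
      have h1 := hmin (α 1) (by linarith)
      have h2 := hmin (α 2) (by linarith)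
      have h3' := hmin (α 3) le_rfl
      rw [min_eq_left (a := α 4 - ζ) (by linarith), min_eq_left (a := α 5 - ζ) (by linarith)] at h
      have hs := sq_nonneg (min (α 4 + α 5) 0)
      obtain ⟨x, hxd⟩ : ∃ x, x = ζ - α 3 := ⟨_, rfl⟩
      obtain ⟨y, hyd⟩ : ∃ y, y = ζ - α 4 := ⟨_, rfl⟩
      obtain ⟨z, hzd⟩ : ∃ z, z = ζ - α 5 := ⟨_, rfl⟩
      have key : 4 * ζ ^ 2 ≤ 4 * x ^ 2 + y ^ 2 + z ^ 2 := by
        subst hxd hyd hzd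
        linarith
      have hx0 : 0 ≤ x := by linarith
      have hxy : x ≤ y := by linarith
      have hyz : y ≤ z := by linarith
      have hT : (x + y + z) ^ 2 ≤ (2 * ζ) ^ 2 := pow_le_pow_left₀ (by linarith) (by linarith) 2
      have hxx : x * x ≤ x * y := by gcongr
      have hxz : x * x ≤ x * z := mul_le_mul_of_nonneg_left (by linarith) hx0
      have hyy : y * y ≤ y * z := mul_le_mul_of_nonneg_left hyz (by linarith)
      have hxy2 : x * x ≤ y * y := mul_self_le_mul_self hx0 hxy
      have hy : y = 0 := by nlinarith
      have hx1 : x = 0 := by linarith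
      subst hy hx1
      nlinarith
  · rintro (h | h)
    · subst h
      repeat rw [min_eq_right (by linarith)]
      ring
    · have h5 : α 5 = -ζ := by linarith
      rw [min_eq_right (a := α 0 - ζ) (by linarith), min_eq_right (a := α 1 - ζ) (by linarith),
        min_eq_right (a := α 2 - ζ) (by linarith), min_eq_right (a := α 3 - ζ) (by linarith),
        min_eq_left (a := α 5 - ζ) (by linarith), h5]
      ring_nf
end
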